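/- arXiv:1803.11260 — 6 statements merged into one kernel-verified Lean document; each statement's English description precedes it below -/
import Mathlib

section
/- Let Λ* ⊆ (F⁺_d)^N be a factorial language and T_μ̄ the operators on ℓ²(Λ*) defined in the context. Then T is Nica-covariant: for all μ̄, ν̄ ∈ (F⁺_d)^N, T_μ̄ T_μ̄* T_ν̄ T_ν̄* = T_{μ̄∨ν̄} T_{μ̄∨ν̄}* if the least upper bound μ̄ ∨ ν̄ exists (i.e. for every i ∈ [N] one of μ_i, ν_i is a prefix of the other) and μ̄ ∨ ν̄ ∈ Λ*, and T_μ̄ T_μ̄* T_ν̄ T_ν̄* = 0 otherwise. -/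
open scoped ENNReal

/-- The `N`-fold direct product of the free monoid on `d` generators,
with coordinatewise multiplication. -/
abbrev MWord (d N : ℕ) : Type := Fin N → FreeMonoid (Fin d)

/-- The element of `(F⁺_d)^N` whose `i`-th coordinate is the one-letter word `k`
and whose other coordinates are empty. -/
def delta (d N : ℕ) (i : Fin N) (k : Fin d) : MWord d N :=
  fun j => if j = i then FreeMonoid.of k else 1

/-- `ν` is a factor of `μ` if `μ = w * ν * q` for some `w, q`. -/
def IsFactor {d N : ℕ} (ν μ : MWord d N) : Prop :=
  ∃ w q : MWord d N, μ = w * ν * q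

/-- A factorial language in `(F⁺_d)^N`. -/
def IsFL {d N : ℕ} (Λ : Set (MWord d N)) : Prop :=
  (∀ i : Fin N, ∃ k : Fin d, delta d N i k ∈ Λ) ∧
  ∀ μ ∈ Λ, ∀ ν : MWord d N, IsFactor ν μ → ν ∈ Λ

/-- The multilength of a multiword. -/
def mlen {d N : ℕ} (μ : MWord d N) : Fin N → ℕ := fun i => (μ i).length

/-- The support of a multiword. -/
def msupp {d N : ℕ} (μ : MWord d N) : Set (Fin N) := {i | μ i ≠ 1}

noncomputable section

/-- The Hilbert space `ℓ²(Λ*)`. -/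
abbrev ell2 {d N : ℕ} (Λ : Set (MWord d N)) : Type := lp (fun _ : Λ => ℂ) 2

/-- The standard orthonormal basis vector `e_w̄` of `ℓ²(Λ*)`. -/
def evec {d N : ℕ} (Λ : Set (MWord d N)) (w : Λ) : ell2 Λ :=
  letI := Classical.decEq (↥Λ)
  lp.single 2 w 1

end

/-- The coordinatewise prefix order on `(F⁺_d)^N`: `μ̄ ≤ ν̄` iff in each coordinate `μ_i`
is a prefix of `ν_i`. -/
def MPrefix {d N : ℕ} (μ ν : MWord d N) : Prop :=
  ∀ i : Fin N, ∃ q : FreeMonoid (Fin d), ν i = μ i * q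

/-- `ρ̄` is the least upper bound `μ̄ ∨ ν̄` of `μ̄` and `ν̄` in the coordinatewise
prefix order. -/
def IsJoin {d N : ℕ} (μ ν ρ : MWord d N) : Prop :=
  MPrefix μ ρ ∧ MPrefix ν ρ ∧ ∀ τ : MWord d N, MPrefix μ τ → MPrefix ν τ → MPrefix ρ τ

theorem MPrefix.exists_mul {d N : ℕ} {μ ν : MWord d N} (h : MPrefix μ ν) :
    ∃ q : MWord d N, ν = μ * q := by
  choose q hq using h
  exact ⟨q, funext hq⟩

theorem MPrefix.trans {d N : ℕ} {μ ν ρ : MWord d N} (h₁ : MPrefix μ ν) (h₂ : MPrefix ν ρ) :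
    MPrefix μ ρ := by
  intro i
  obtain ⟨p, hp⟩ := h₁ i
  obtain ⟨q, hq⟩ := h₂ i
  exact ⟨p * q, by rw [hq, hp, mul_assoc]⟩

theorem IsFL.mem_of_mPrefix {d N : ℕ} {Λ : Set (MWord d N)} (hFL : IsFL Λ) {μ w : MWord d N}
    (hw : w ∈ Λ) (h : MPrefix μ w) : μ ∈ Λ := by
  obtain ⟨q, rfl⟩ := h.exists_mul
  exact hFL.2 _ hw _ ⟨1, q, by rw [one_mul]⟩

theorem IsFL.right_mem {d N : ℕ} {Λ : Set (MWord d N)} (hFL : IsFL Λ) {μ v : MWord d N}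
    (h : μ * v ∈ Λ) : v ∈ Λ :=
  hFL.2 _ h _ ⟨μ, 1, by rw [mul_one]⟩

/-- Two prefixes of the same word in a free monoid are comparable. -/
theorem FreeMonoid.prefix_or_prefix {α : Type*} {a b w : FreeMonoid α}
    (ha : ∃ q, w = a * q) (hb : ∃ q, w = b * q) : (∃ q, b = a * q) ∨ ∃ q, a = b * q := by
  obtain ⟨p, hp⟩ := ha
  obtain ⟨q, hq⟩ := hb
  have h₁ : a.toList <+: w.toList := ⟨p.toList, by rw [hp, FreeMonoid.toList_mul]⟩
  have h₂ : b.toList <+: w.toList := ⟨q.toList, by rw [hq, FreeMonoid.toList_mul]⟩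
  exact (List.prefix_or_prefix_of_prefix h₁ h₂).imp
    (fun ⟨t, ht⟩ => ⟨FreeMonoid.ofList t, ht.symm⟩)
    (fun ⟨t, ht⟩ => ⟨FreeMonoid.ofList t, ht.symm⟩)

/-- Multiwords with a common upper bound have a least upper bound. -/
theorem exists_isJoin_of_mPrefix {d N : ℕ} {μ ν w : MWord d N}
    (hμ : MPrefix μ w) (hν : MPrefix ν w) : ∃ ρ, IsJoin μ ν ρ := by
  have key : ∀ i, ∃ r : FreeMonoid (Fin d), (∃ q, r = μ i * q) ∧ (∃ q, r = ν i * q) ∧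
      (r = μ i ∨ r = ν i) := fun i => by
    rcases FreeMonoid.prefix_or_prefix (hμ i) (hν i) with h | h
    · exact ⟨ν i, h, ⟨1, (mul_one _).symm⟩, Or.inr rfl⟩
    · exact ⟨μ i, ⟨1, (mul_one _).symm⟩, h, Or.inl rfl⟩
  choose ρ h₁ h₂ h₃ using key
  refine ⟨ρ, h₁, h₂, fun τ hμτ hντ i => ?_⟩
  rcases h₃ i with h | h <;> rw [h]
  exacts [hμτ i, hντ i]

theorem evec_apply {d N : ℕ} {Λ : Set (MWord d N)} (v w : Λ) [Decidable (w = v)] :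
    (evec Λ v) w = if w = v then (1 : ℂ) else 0 := by
  classical
  simp [evec, Pi.single_apply]

theorem inner_evec_left {d N : ℕ} {Λ : Set (MWord d N)} (v : Λ) (f : ell2 Λ) :
    inner ℂ (evec Λ v) f = f v := by
  let := Classical.decEq Λ
  rw [evec, lp.inner_single_left]
  simp

theorem ext_evec {d N : ℕ} {Λ : Set (MWord d N)} {A B : ell2 Λ →L[ℂ] ell2 Λ}
    (h : ∀ w, A (evec Λ w) = B (evec Λ w)) : A = B := by
  classical
  refine lp.ext_continuousLinearMap (ENNReal.ofNat_ne_top (n := 2)) fun w => ?_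
  ext1
  have hw := h w
  unfold evec at hw
  simp only [ContinuousLinearMap.comp_apply, lp.singleContinuousLinearMap_apply]
  convert hw

section ShiftOperator

variable {d N : ℕ} {Λ : Set (MWord d N)} {μ : MWord d N} {S : ell2 Λ →L[ℂ] ell2 Λ}

theorem star_shift_apply_mul
    (hS₁ : ∀ (w : Λ) (h : μ * (w : MWord d N) ∈ Λ),
      S (evec Λ w) = evec Λ ⟨μ * (w : MWord d N), h⟩)
    (hS₂ : ∀ w : Λ, μ * (w : MWord d N) ∉ Λ → S (evec Λ w) = 0)
    (v : Λ) (hv : μ * (v : MWord d N) ∈ Λ) :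
    star S (evec Λ ⟨μ * (v : MWord d N), hv⟩) = evec Λ v := by
  classical
  ext u
  rw [← inner_evec_left, ContinuousLinearMap.star_eq_adjoint,
    ContinuousLinearMap.adjoint_inner_right, evec_apply]
  by_cases hu : μ * (u : MWord d N) ∈ Λ
  · rw [hS₁ u hu, inner_evec_left, evec_apply]
    simp [Subtype.ext_iff]
  · rw [hS₂ u hu, inner_zero_left, if_neg]
    rintro rfl
    exact hu hv

theorem star_shift_apply_of_not_mPrefix
    (hS₁ : ∀ (w : Λ) (h : μ * (w : MWord d N) ∈ Λ),
      S (evec Λ w) = evec Λ ⟨μ * (w : MWord d N), h⟩)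
    (hS₂ : ∀ w : Λ, μ * (w : MWord d N) ∉ Λ → S (evec Λ w) = 0)
    (w : Λ) (hw : ¬ MPrefix μ (w : MWord d N)) : star S (evec Λ w) = 0 := by
  classical
  ext u
  rw [← inner_evec_left, ContinuousLinearMap.star_eq_adjoint,
    ContinuousLinearMap.adjoint_inner_right]
  by_cases hu : μ * (u : MWord d N) ∈ Λ
  · rw [hS₁ u hu, inner_evec_left, evec_apply, if_neg]
    · rfl
    · rintro rfl
      exact hw fun i => ⟨_, rfl⟩
  · rw [hS₂ u hu, inner_zero_left]
    rfl

open scoped Classical in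
/-- The range projection of a shift operator is diagonal. -/
theorem shift_mul_star_apply (hFL : IsFL Λ)
    (hS₁ : ∀ (w : Λ) (h : μ * (w : MWord d N) ∈ Λ),
      S (evec Λ w) = evec Λ ⟨μ * (w : MWord d N), h⟩)
    (hS₂ : ∀ w : Λ, μ * (w : MWord d N) ∉ Λ → S (evec Λ w) = 0) (w : Λ) :
    (S * star S) (evec Λ w) = if MPrefix μ (w : MWord d N) then evec Λ w else 0 := by
  rw [mul_apply_eq_comp]
  split_ifs with h
  · obtain ⟨w, hw⟩ := w
    obtain ⟨v, rfl⟩ := h.exists_mul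
    have hv := hFL.right_mem hw
    rw [star_shift_apply_mul hS₁ hS₂ ⟨v, hv⟩ hw, hS₁ ⟨v, hv⟩ hw]
  · rw [star_shift_apply_of_not_mPrefix hS₁ hS₂ w h, map_zero]

end ShiftOperator

/-- The family `T` of shift operators of a factorial language `Λ* ⊆ (F⁺_d)^N` is
Nica-covariant: for all `μ̄, ν̄`, if the least upper bound `μ̄ ∨ ν̄` exists and lies in `Λ*`
then `T_μ̄ T_μ̄* T_ν̄ T_ν̄* = T_{μ̄∨ν̄} T_{μ̄∨ν̄}*`, and otherwise
`T_μ̄ T_μ̄* T_ν̄ T_ν̄* = 0`. -/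
theorem shift_operators_nica_covariant {d N : ℕ} (Λ : Set (MWord d N)) (hFL : IsFL Λ)
    (T : MWord d N → (ell2 Λ →L[ℂ] ell2 Λ))
    (hT1 : ∀ (μ : MWord d N) (w : Λ) (h : μ * (w : MWord d N) ∈ Λ),
      T μ (evec Λ w) = evec Λ ⟨μ * (w : MWord d N), h⟩)
    (hT2 : ∀ (μ : MWord d N) (w : Λ), μ * (w : MWord d N) ∉ Λ → T μ (evec Λ w) = 0) :
    ∀ μ ν : MWord d N,
      (∀ ρ : MWord d N, IsJoin μ ν ρ → ρ ∈ Λ →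
        T μ * star (T μ) * (T ν * star (T ν)) = T ρ * star (T ρ)) ∧
      ((¬ ∃ ρ : MWord d N, IsJoin μ ν ρ ∧ ρ ∈ Λ) →
        T μ * star (T μ) * (T ν * star (T ν)) = 0) := by
  classical
  intro μ ν
  have key := fun κ w => shift_mul_star_apply hFL (hT1 κ) (hT2 κ) w
  refine ⟨fun ρ hρ _ => ext_evec fun w => ?_, fun hne => ext_evec fun w => ?_⟩
  · rw [mul_apply_eq_comp, key ν, key ρ]
    by_cases hν : MPrefix ν (w : MWord d N)
    · rw [if_pos hν, key μ]
      exact if_congr ⟨fun hμ => hρ.2.2 _ hμ hν, hρ.1.trans⟩ rfl rfl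
    · rw [if_neg hν, if_neg fun h => hν (hρ.2.1.trans h), map_zero]
  · rw [mul_apply_eq_comp, key ν, zero_apply]
    split_ifs with hν
    · rw [key μ, if_neg]
      intro hμ
      obtain ⟨ρ, hρ⟩ := exists_isJoin_of_mPrefix hμ hν
      exact hne ⟨ρ, hρ, hFL.mem_of_mPrefix w.2 (hρ.2.2 _ hμ hν)⟩
    · rw [map_zero]
end

section
/- Let Λ* ⊆ (F⁺_d)^N be a factorial language, T_μ̄ the operators on ℓ²(Λ*) defined in the context, and A the C*-algebra of checkers. Then: (a) every T_μ̄* T_μ̄ commutes with every T_ν̄* T_ν̄ and with every T_ν̄ T_ν̄* (μ̄, ν̄ ∈ Λ*); consequently every T_ν̄ T_ν̄* commutes with every element of A; (b) for each i ∈ [N] and k ∈ [d], the map α_{δ_i(k)} : a ↦ T_{δ_i(k)}* a T_{δ_i(k)} maps A into A and is a *-homomorphism A → A; (c) for every a ∈ A and μ̄ ∈ Λ*, a T_μ̄ = T_μ̄ α_μ̄(a), where α_μ̄(a) := T_μ̄* a T_μ̄. -/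
open scoped ENNReal

noncomputable section

/-- The C*-algebra of checkers of a factorial language: the unital commutative C*-subalgebra
of `B(ℓ²(Λ*))` generated by the projections `T_μ̄* T_μ̄`, `μ̄ ∈ Λ*`. -/
def checkers {d N : ℕ} (Λ : Set (MWord d N)) (T : MWord d N → (ell2 Λ →L[ℂ] ell2 Λ)) :
    StarSubalgebra ℂ (ell2 Λ →L[ℂ] ell2 Λ) :=
  (StarAlgebra.adjoin ℂ {x : ell2 Λ →L[ℂ] ell2 Λ | ∃ μ ∈ Λ, x = star (T μ) * T μ}).topologicalClosure

section Diagonal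

variable {d N : ℕ} {Λ : Set (MWord d N)}

open scoped InnerProductSpace

theorem evec_apply_self (w : Λ) : (evec Λ w : ell2 Λ) w = 1 := by
  simp [evec]

theorem evec_apply_of_ne {v w : Λ} (h : v ≠ w) : (evec Λ w : ell2 Λ) v = 0 := by
  simp [evec, h]

theorem inner_evec_left_s7 (w : Λ) (f : ell2 Λ) : ⟪evec Λ w, f⟫_ℂ = f w := by
  rw [evec, @lp.inner_single_left _ ℂ _ _ _ _ (Classical.decEq (↥Λ))]
  simp

theorem ext_evec_s7 {a b : ell2 Λ →L[ℂ] ell2 Λ} (h : ∀ w, a (evec Λ w) = b (evec Λ w)) :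
    a = b := by
  let := Classical.decEq (↥Λ)
  refine lp.ext_continuousLinearMap (by simp) fun w => ?_
  refine ContinuousLinearMap.ext_ring ?_
  simpa [evec] using h w

theorem star_apply_coord (a : ell2 Λ →L[ℂ] ell2 Λ) (f : ell2 Λ) (w : Λ) :
    (star a f : ell2 Λ) w = ⟪a (evec Λ w), f⟫_ℂ := by
  rw [← inner_evec_left_s7, ContinuousLinearMap.star_eq_adjoint,
    ContinuousLinearMap.adjoint_inner_right]

theorem apply_evec_eq_smul {a : ell2 Λ →L[ℂ] ell2 Λ}
    (ha : ∀ v w : Λ, v ≠ w → ⟪evec Λ v, a (evec Λ w)⟫_ℂ = 0) (w : Λ) :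
    a (evec Λ w) = (a (evec Λ w) : ell2 Λ) w • evec Λ w := by
  ext v
  by_cases h : v = w
  · subst h
    simp [evec_apply_self]
  · simpa [evec_apply_of_ne h, inner_evec_left_s7] using ha v w h

/-- The diagonal operators with respect to the standard basis of `ℓ²(Λ*)`. -/
def diagonalOperators (Λ : Set (MWord d N)) : StarSubalgebra ℂ (ell2 Λ →L[ℂ] ell2 Λ) where
  carrier := {a | ∀ v w : Λ, v ≠ w → ⟪evec Λ v, a (evec Λ w)⟫_ℂ = 0}
  add_mem' {a b} ha hb v w h := by
    simp [ha v w h, hb v w h]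
  mul_mem' {a b} ha hb v w h := by
    rw [mul_apply_eq_comp, apply_evec_eq_smul hb, map_smul, inner_smul_right,
      ha v w h, mul_zero]
  algebraMap_mem' c v w h := by
    rw [Algebra.algebraMap_eq_smul_one, smul_apply,
      one_apply_eq_self, inner_smul_right, inner_evec_left_s7, evec_apply_of_ne h,
      mul_zero]
  star_mem' {a} ha v w h := by
    rw [ContinuousLinearMap.star_eq_adjoint, ContinuousLinearMap.adjoint_inner_right,
      ← inner_conj_symm, ha w v h.symm, map_zero]

theorem mem_diagonalOperators_of_smul {a : ell2 Λ →L[ℂ] ell2 Λ}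
    (ha : ∀ w, ∃ c : ℂ, a (evec Λ w) = c • evec Λ w) : a ∈ diagonalOperators Λ := by
  intro v w h
  obtain ⟨c, hc⟩ := ha w
  rw [hc, inner_smul_right, inner_evec_left_s7, evec_apply_of_ne h, mul_zero]

theorem isClosed_diagonalOperators :
    IsClosed (diagonalOperators Λ : Set (ell2 Λ →L[ℂ] ell2 Λ)) := by
  have : (diagonalOperators Λ : Set (ell2 Λ →L[ℂ] ell2 Λ)) =
      ⋂ (v : Λ) (w : Λ) (_ : v ≠ w), {a | ⟪evec Λ v, a (evec Λ w)⟫_ℂ = 0} := by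
    ext a
    simp only [Set.mem_iInter]
    rfl
  rw [this]
  exact isClosed_iInter fun v => isClosed_iInter fun w => isClosed_iInter fun _ =>
    isClosed_eq (by fun_prop) continuous_const

theorem commute_of_mem_diagonalOperators {a b : ell2 Λ →L[ℂ] ell2 Λ}
    (ha : a ∈ diagonalOperators Λ) (hb : b ∈ diagonalOperators Λ) : Commute a b := by
  refine ext_evec_s7 fun w => ?_
  rw [mul_apply_eq_comp, mul_apply_eq_comp,
    apply_evec_eq_smul ha, apply_evec_eq_smul hb, map_smul, map_smul,
    apply_evec_eq_smul ha, apply_evec_eq_smul hb, smul_smul, smul_smul]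
  simp [evec_apply_self, mul_comm]

end Diagonal

/-- `T` is the family of shift operators on `ℓ²(Λ*)`. -/
structure IsShiftFamily {d N : ℕ} (Λ : Set (MWord d N))
    (T : MWord d N → (ell2 Λ →L[ℂ] ell2 Λ)) : Prop where
  apply_of_mem : ∀ (μ : MWord d N) (w : Λ) (h : μ * (w : MWord d N) ∈ Λ),
    T μ (evec Λ w) = evec Λ ⟨μ * (w : MWord d N), h⟩
  apply_of_notMem : ∀ (μ : MWord d N) (w : Λ), μ * (w : MWord d N) ∉ Λ → T μ (evec Λ w) = 0

namespace IsFL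

variable {d N : ℕ} {Λ : Set (MWord d N)}

theorem mem_of_mul_mem_left (hFL : IsFL Λ) {μ w : MWord d N} (h : μ * w ∈ Λ) : μ ∈ Λ :=
  hFL.2 _ h μ ⟨1, w, by rw [one_mul]⟩

theorem mem_of_mul_mem_right (hFL : IsFL Λ) {μ w : MWord d N} (h : μ * w ∈ Λ) : w ∈ Λ :=
  hFL.2 _ h w ⟨μ, 1, by rw [mul_one]⟩

end IsFL

namespace IsShiftFamily

variable {d N : ℕ} {Λ : Set (MWord d N)} {T : MWord d N → (ell2 Λ →L[ℂ] ell2 Λ)}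

open scoped InnerProductSpace

theorem star_apply_mul (hT : IsShiftFamily Λ T) (μ : MWord d N) (w : Λ)
    (h : μ * (w : MWord d N) ∈ Λ) :
    star (T μ) (evec Λ ⟨μ * (w : MWord d N), h⟩) = evec Λ w := by
  ext v
  rw [star_apply_coord]
  by_cases hv : μ * (v : MWord d N) ∈ Λ
  · rw [hT.apply_of_mem μ v hv, inner_evec_left_s7]
    by_cases hvw : v = w
    · subst hvw
      rw [evec_apply_self, evec_apply_self]
    · rw [evec_apply_of_ne hvw, evec_apply_of_ne]
      exact fun he => hvw (Subtype.ext (mul_left_cancel (Subtype.ext_iff.1 he)))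
  · rw [hT.apply_of_notMem μ v hv, inner_zero_left, evec_apply_of_ne]
    rintro rfl
    exact hv h

theorem star_apply_of_forall_ne (hT : IsShiftFamily Λ T) (μ : MWord d N) (v : Λ)
    (h : ∀ w : Λ, μ * (w : MWord d N) ≠ v) : star (T μ) (evec Λ v) = 0 := by
  ext w
  rw [star_apply_coord]
  by_cases hw : μ * (w : MWord d N) ∈ Λ
  · rw [hT.apply_of_mem μ w hw, inner_evec_left_s7, evec_apply_of_ne]
    · rfl
    · exact fun he => h w (Subtype.ext_iff.1 he)
  · rw [hT.apply_of_notMem μ w hw, inner_zero_left]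
    rfl

theorem star_mul_self_mem_diagonalOperators (hT : IsShiftFamily Λ T) (μ : MWord d N) :
    star (T μ) * T μ ∈ diagonalOperators Λ := by
  refine mem_diagonalOperators_of_smul fun w => ?_
  rw [mul_apply_eq_comp]
  by_cases hw : μ * (w : MWord d N) ∈ Λ
  · exact ⟨1, by rw [hT.apply_of_mem μ w hw, hT.star_apply_mul, one_smul]⟩
  · exact ⟨0, by rw [hT.apply_of_notMem μ w hw, map_zero, zero_smul]⟩

theorem mul_star_self_mem_diagonalOperators (hT : IsShiftFamily Λ T) (μ : MWord d N) :
    T μ * star (T μ) ∈ diagonalOperators Λ := by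
  refine mem_diagonalOperators_of_smul fun v => ?_
  rw [mul_apply_eq_comp]
  by_cases hv : ∃ w : Λ, μ * (w : MWord d N) = v
  · obtain ⟨w, hw⟩ := hv
    obtain ⟨v, hv⟩ := v
    subst hw
    exact ⟨1, by rw [hT.star_apply_mul, hT.apply_of_mem μ w hv, one_smul]⟩
  · exact ⟨0, by rw [hT.star_apply_of_forall_ne μ v (not_exists.1 hv), map_zero, zero_smul]⟩

theorem mul_star_mul_self (hT : IsShiftFamily Λ T) (μ : MWord d N) :
    T μ * star (T μ) * T μ = T μ := by
  refine ext_evec_s7 fun w => ?_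
  rw [mul_apply_eq_comp, mul_apply_eq_comp]
  by_cases hw : μ * (w : MWord d N) ∈ Λ
  · rw [hT.apply_of_mem μ w hw, hT.star_apply_mul, hT.apply_of_mem μ w hw]
  · rw [hT.apply_of_notMem μ w hw, map_zero, map_zero]

theorem map_mul (hT : IsShiftFamily Λ T) (hFL : IsFL Λ) (μ ν : MWord d N) :
    T (μ * ν) = T μ * T ν := by
  refine ext_evec_s7 fun w => ?_
  rw [mul_apply_eq_comp]
  by_cases hν : ν * (w : MWord d N) ∈ Λ
  · rw [hT.apply_of_mem ν w hν]
    by_cases hμ : μ * (ν * (w : MWord d N)) ∈ Λ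
    · rw [hT.apply_of_mem μ ⟨_, hν⟩ hμ, hT.apply_of_mem (μ * ν) w (by rwa [mul_assoc])]
      congr 2
      exact mul_assoc _ _ _
    · rw [hT.apply_of_notMem μ ⟨_, hν⟩ hμ, hT.apply_of_notMem (μ * ν) w (by rwa [mul_assoc])]
  · rw [hT.apply_of_notMem ν w hν, map_zero, hT.apply_of_notMem]
    rw [mul_assoc]
    exact fun h => hν (hFL.mem_of_mul_mem_right h)

theorem eq_zero_of_notMem (hT : IsShiftFamily Λ T) (hFL : IsFL Λ) {μ : MWord d N}
    (hμ : μ ∉ Λ) : T μ = 0 :=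
  ext_evec_s7 fun w => hT.apply_of_notMem μ w fun h => hμ (hFL.mem_of_mul_mem_left h)

theorem checkers_le_diagonalOperators (hT : IsShiftFamily Λ T) :
    checkers Λ T ≤ diagonalOperators Λ := by
  refine StarSubalgebra.topologicalClosure_minimal (StarAlgebra.adjoin_le ?_)
    isClosed_diagonalOperators
  rintro _ ⟨μ, -, rfl⟩
  exact hT.star_mul_self_mem_diagonalOperators μ

theorem star_mul_self_mem_checkers (hT : IsShiftFamily Λ T) (hFL : IsFL Λ) (μ : MWord d N) :
    star (T μ) * T μ ∈ checkers Λ T := by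
  by_cases hμ : μ ∈ Λ
  · exact StarSubalgebra.le_topologicalClosure _ (StarAlgebra.subset_adjoin ℂ _ ⟨μ, hμ, rfl⟩)
  · rw [hT.eq_zero_of_notMem hFL hμ, mul_zero]
    exact zero_mem _

theorem mul_eq_mul_conj (hT : IsShiftFamily Λ T) {a : ell2 Λ →L[ℂ] ell2 Λ}
    (ha : a ∈ diagonalOperators Λ) (μ : MWord d N) :
    a * T μ = T μ * (star (T μ) * a * T μ) := by
  calc a * T μ = a * (T μ * star (T μ)) * T μ := by
        rw [mul_assoc, hT.mul_star_mul_self]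
    _ = T μ * star (T μ) * a * T μ := by
        rw [(commute_of_mem_diagonalOperators ha (hT.mul_star_self_mem_diagonalOperators μ)).eq]
    _ = T μ * (star (T μ) * a * T μ) := by simp only [mul_assoc]

theorem conj_mul (hT : IsShiftFamily Λ T) {b : ell2 Λ →L[ℂ] ell2 Λ}
    (hb : b ∈ diagonalOperators Λ) (a : ell2 Λ →L[ℂ] ell2 Λ) (μ : MWord d N) :
    star (T μ) * (a * b) * T μ = (star (T μ) * a * T μ) * (star (T μ) * b * T μ) := by
  rw [mul_assoc (star (T μ) * a) (T μ), ← hT.mul_eq_mul_conj hb]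
  simp only [mul_assoc]

theorem conj_star (a : ell2 Λ →L[ℂ] ell2 Λ) (μ : MWord d N) :
    star (T μ) * star a * T μ = star (star (T μ) * a * T μ) := by
  simp only [star_mul, star_star, mul_assoc]

theorem conj_mem_checkers (hT : IsShiftFamily Λ T) (hFL : IsFL Λ) (μ : MWord d N)
    {a : ell2 Λ →L[ℂ] ell2 Λ} (ha : a ∈ checkers Λ T) :
    star (T μ) * a * T μ ∈ checkers Λ T := by
  have hclosed : IsClosed (checkers Λ T : Set (ell2 Λ →L[ℂ] ell2 Λ)) :=
    StarSubalgebra.isClosed_topologicalClosure _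
  refine closure_minimal (t := (fun a => star (T μ) * a * T μ) ⁻¹'
    (checkers Λ T : Set (ell2 Λ →L[ℂ] ell2 Λ))) (fun a ha => ?_)
    (hclosed.preimage (by fun_prop)) ha
  change star (T μ) * a * T μ ∈ checkers Λ T
  induction ha using StarAlgebra.adjoin_induction with
  | mem x hx =>
    obtain ⟨ν, -, rfl⟩ := hx
    have h := hT.star_mul_self_mem_checkers hFL (ν * μ)
    rw [hT.map_mul hFL, star_mul] at h
    simpa only [mul_assoc] using h
  | algebraMap c =>
    rw [Algebra.algebraMap_eq_smul_one, mul_smul_comm, mul_one, smul_mul_assoc]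
    exact (checkers Λ T).smul_mem (hT.star_mul_self_mem_checkers hFL μ) c
  | add x y _ _ hx hy =>
    rw [mul_add, add_mul]
    exact add_mem hx hy
  | mul x y _ hy hx' hy' =>
    rw [hT.conj_mul (hT.checkers_le_diagonalOperators
      (StarSubalgebra.le_topologicalClosure _ hy))]
    exact mul_mem hx' hy'
  | star x _ hx =>
    rw [conj_star]
    exact star_mem hx

end IsShiftFamily

/-- For the shift operators `T` of a factorial language `Λ*` and its C*-algebra of
checkers `A`:
(a) every `T_μ̄* T_μ̄` commutes with every `T_ν̄* T_ν̄` and with every `T_ν̄ T_ν̄*`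
    (`μ̄, ν̄ ∈ Λ*`); consequently every `T_ν̄ T_ν̄*` commutes with every element of `A`;
(b) for each `i, k`, `α_{δ_i(k)} : a ↦ T_{δ_i(k)}* a T_{δ_i(k)}` maps `A` into `A` and is a
    *-homomorphism `A → A`;
(c) for every `a ∈ A` and `μ̄ ∈ Λ*`, `a T_μ̄ = T_μ̄ α_μ̄(a)` where
    `α_μ̄(a) = T_μ̄* a T_μ̄`. -/
theorem checkers_properties {d N : ℕ} (Λ : Set (MWord d N)) (hFL : IsFL Λ)
    (T : MWord d N → (ell2 Λ →L[ℂ] ell2 Λ))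
    (hT1 : ∀ (μ : MWord d N) (w : Λ) (h : μ * (w : MWord d N) ∈ Λ),
      T μ (evec Λ w) = evec Λ ⟨μ * (w : MWord d N), h⟩)
    (hT2 : ∀ (μ : MWord d N) (w : Λ), μ * (w : MWord d N) ∉ Λ → T μ (evec Λ w) = 0) :
    -- (a)
    (∀ μ ∈ Λ, ∀ ν ∈ Λ,
      Commute (star (T μ) * T μ) (star (T ν) * T ν) ∧
      Commute (star (T μ) * T μ) (T ν * star (T ν))) ∧
    (∀ ν ∈ Λ, ∀ a ∈ checkers Λ T, Commute (T ν * star (T ν)) a) ∧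
    -- (b)
    (∀ (i : Fin N) (k : Fin d),
      (∀ a ∈ checkers Λ T, star (T (delta d N i k)) * a * T (delta d N i k) ∈ checkers Λ T) ∧
      (∀ a ∈ checkers Λ T, ∀ b ∈ checkers Λ T,
        star (T (delta d N i k)) * (a + b) * T (delta d N i k) =
          star (T (delta d N i k)) * a * T (delta d N i k) +
            star (T (delta d N i k)) * b * T (delta d N i k) ∧
        star (T (delta d N i k)) * (a * b) * T (delta d N i k) =
          (star (T (delta d N i k)) * a * T (delta d N i k)) *
            (star (T (delta d N i k)) * b * T (delta d N i k))) ∧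
      (∀ a ∈ checkers Λ T,
        star (T (delta d N i k)) * star a * T (delta d N i k) =
          star (star (T (delta d N i k)) * a * T (delta d N i k))) ∧
      (∀ a ∈ checkers Λ T, ∀ c : ℂ,
        star (T (delta d N i k)) * (c • a) * T (delta d N i k) =
          c • (star (T (delta d N i k)) * a * T (delta d N i k)))) ∧
    -- (c)
    (∀ a ∈ checkers Λ T, ∀ μ ∈ Λ, a * T μ = T μ * (star (T μ) * a * T μ)) := by
  have hT : IsShiftFamily Λ T := ⟨hT1, hT2⟩
  have hdiag := hT.checkers_le_diagonalOperators
  refine ⟨fun μ _ ν _ => ⟨?_, ?_⟩, fun ν _ a ha => ?_, fun i k => ⟨?_, ?_, ?_, ?_⟩, ?_⟩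
  · exact commute_of_mem_diagonalOperators (hT.star_mul_self_mem_diagonalOperators μ)
      (hT.star_mul_self_mem_diagonalOperators ν)
  · exact commute_of_mem_diagonalOperators (hT.star_mul_self_mem_diagonalOperators μ)
      (hT.mul_star_self_mem_diagonalOperators ν)
  · exact commute_of_mem_diagonalOperators (hT.mul_star_self_mem_diagonalOperators ν) (hdiag ha)
  · exact fun a ha => hT.conj_mem_checkers hFL _ ha
  · exact fun a _ b hb => ⟨by rw [mul_add, add_mul], hT.conj_mul (hdiag hb) a _⟩
  · exact fun a _ => IsShiftFamily.conj_star a _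
  · exact fun a _ c => by rw [mul_smul_comm, smul_mul_assoc]
  · exact fun a ha μ _ => hT.mul_eq_mul_conj (hdiag ha) μ

end
end

section
/- Let Λ* ⊆ (F⁺_d)^N be a factorial language and fix n̄ ∈ ℤ₊^N. Then Ω_n̄ = Λ*/∼_n̄ is finite, and there is a unital *-isomorphism φ_n̄ : A_n̄ → C(Ω_n̄, ℂ) such that for every μ̄ ∈ Λ* with |μ̄| ≤ n̄, φ_n̄(T_μ̄* T_μ̄) is the characteristic function of { [w̄]_n̄ ∈ Ω_n̄ : μ̄ * w̄ ∈ Λ* } (this set is well defined since the condition μ̄ * w̄ ∈ Λ* depends only on the class [w̄]_n̄ when |μ̄| ≤ n̄). -/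
open scoped ENNReal

/-- The relation `∼_n̄` on a language: equality of left multipliers of multilength `≤ n̄`. -/
def simRel {d N : ℕ} (Λ : Set (MWord d N)) (n : Fin N → ℕ) (μ ν : MWord d N) : Prop :=
  ∀ w : MWord d N, mlen w ≤ n → (w * μ ∈ Λ ↔ w * ν ∈ Λ)

/-- `∼_n̄` as a setoid on `Λ*`. -/
def simSetoid {d N : ℕ} (Λ : Set (MWord d N)) (n : Fin N → ℕ) : Setoid ↥Λ where
  r μ ν := simRel Λ n ↑μ ↑ν
  iseqv := ⟨fun _ _ _ => Iff.rfl, fun h w hw => (h w hw).symm,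
    fun h1 h2 w hw => (h1 w hw).trans (h2 w hw)⟩

/-- `Ω_n̄ = Λ*/∼_n̄`. -/
def OmegaN {d N : ℕ} (Λ : Set (MWord d N)) (n : Fin N → ℕ) : Type :=
  Quotient (simSetoid Λ n)

/-- `Ω_n̄` carries the discrete topology. -/
instance {d N : ℕ} (Λ : Set (MWord d N)) (n : Fin N → ℕ) : TopologicalSpace (OmegaN Λ n) := ⊥

noncomputable section

/-- The C*-subalgebra `A_n̄` of `B(ℓ²(Λ*))` generated by the projections `T_μ̄* T_μ̄` with
`μ̄ ∈ Λ*`, `|μ̄| ≤ n̄`. -/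
def checkersLe {d N : ℕ} (Λ : Set (MWord d N)) (T : MWord d N → (ell2 Λ →L[ℂ] ell2 Λ))
    (n : Fin N → ℕ) : StarSubalgebra ℂ (ell2 Λ →L[ℂ] ell2 Λ) :=
  (StarAlgebra.adjoin ℂ {x : ell2 Λ →L[ℂ] ell2 Λ |
    ∃ μ : MWord d N, μ ∈ Λ ∧ mlen μ ≤ n ∧ x = star (T μ) * T μ}).topologicalClosure

section Diagonal

open scoped InnerProductSpace

variable {ι H Ω : Type*} [NormedAddCommGroup H] [InnerProductSpace ℂ H]
  [TopologicalSpace Ω]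

theorem HilbertBasis.clm_ext {b : HilbertBasis ι ℂ H} {x y : H →L[ℂ] H}
    (h : ∀ i, x (b i) = y (b i)) : x = y := by
  refine ContinuousLinearMap.ext_on (s := Set.range b) ?_ ?_
  · exact Submodule.dense_iff_topologicalClosure_eq_top.mpr b.dense_span
  · rintro _ ⟨i, rfl⟩
    exact h i

theorem HilbertBasis.smul_injective (b : HilbertBasis ι ℂ H) (i : ι) :
    Function.Injective fun c : ℂ => c • b i :=
  smul_left_injective ℂ (b.orthonormal.ne_zero i)

variable [CompleteSpace H]

theorem HilbertBasis.star_apply_eq_smul {b : HilbertBasis ι ℂ H} {x : H →L[ℂ] H} {c : ι → ℂ}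
    (h : ∀ i, x (b i) = c i • b i) (i : ι) : star x (b i) = star (c i) • b i := by
  classical
  refine b.repr.injective (lp.ext (funext fun j => ?_))
  rw [b.repr_apply_apply, b.repr_apply_apply, ContinuousLinearMap.star_eq_adjoint,
    ContinuousLinearMap.adjoint_inner_right, h, inner_smul_left, inner_smul_right,
    orthonormal_iff_ite.mp b.orthonormal]
  split_ifs with hij <;> simp [hij]

/-- The operators that are diagonal with respect to `b`, with eigenvalues given by a continuous
function of the label `q i` of the basis vector `b i`. -/
def diagonalThrough (b : HilbertBasis ι ℂ H) (q : ι → Ω) : StarSubalgebra ℂ (H →L[ℂ] H) where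
  carrier := {x | ∃ f : C(Ω, ℂ), ∀ i, x (b i) = f (q i) • b i}
  mul_mem' := by
    rintro x y ⟨f, hf⟩ ⟨g, hg⟩
    exact ⟨f * g, fun i => by simp [hf, hg, smul_smul, mul_comm]⟩
  add_mem' := by
    rintro x y ⟨f, hf⟩ ⟨g, hg⟩
    exact ⟨f + g, fun i => by simp [hf, hg, add_smul]⟩
  algebraMap_mem' c := ⟨algebraMap ℂ C(Ω, ℂ) c, fun i => by
    simp [Algebra.algebraMap_eq_smul_one]⟩
  star_mem' := by
    rintro x ⟨f, hf⟩
    exact ⟨star f, HilbertBasis.star_apply_eq_smul hf⟩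

theorem isClosed_diagonalThrough [DiscreteTopology Ω] (b : HilbertBasis ι ℂ H) {q : ι → Ω}
    (hq : Function.Surjective q) : IsClosed (diagonalThrough b q : Set (H →L[ℂ] H)) := by
  have hset : (diagonalThrough b q : Set (H →L[ℂ] H)) =
      ⋂ i, {x | x (b i) = ⟪b (Function.surjInv hq (q i)), x (b (Function.surjInv hq (q i)))⟫_ℂ •
        b i} := by
    ext x
    simp only [Set.mem_iInter, Set.mem_ofPred_eq]
    constructor
    · rintro ⟨f, hf⟩ i
      rw [hf (Function.surjInv hq (q i)), Function.surjInv_eq hq, inner_smul_right,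
        inner_self_eq_norm_sq_to_K, b.orthonormal.1, hf]
      simp
    · intro h
      exact ⟨⟨fun ω => ⟪b (Function.surjInv hq ω), x (b (Function.surjInv hq ω))⟫_ℂ,
        continuous_of_discreteTopology⟩, h⟩
  rw [hset]
  exact isClosed_iInter fun i => isClosed_eq (by fun_prop) (by fun_prop)

/-- The function of eigenvalues of an operator in `diagonalThrough b q`. -/
def symbol {b : HilbertBasis ι ℂ H} {q : ι → Ω} (x : diagonalThrough b q) : C(Ω, ℂ) :=
  x.2.choose

theorem apply_eq_symbol_smul {b : HilbertBasis ι ℂ H} {q : ι → Ω} (x : diagonalThrough b q)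
    (i : ι) : (x : H →L[ℂ] H) (b i) = symbol x (q i) • b i :=
  x.2.choose_spec i

theorem symbol_eq {b : HilbertBasis ι ℂ H} {q : ι → Ω} (hq : Function.Surjective q)
    {x : diagonalThrough b q} {f : C(Ω, ℂ)}
    (h : ∀ i, (x : H →L[ℂ] H) (b i) = f (q i) • b i) : symbol x = f := by
  ext ω
  obtain ⟨i, rfl⟩ := hq ω
  exact b.smul_injective i ((apply_eq_symbol_smul x i).symm.trans (h i))

/-- `symbol` as a unital `*`-homomorphism. -/
def symbolHom (b : HilbertBasis ι ℂ H) {q : ι → Ω} (hq : Function.Surjective q) :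
    diagonalThrough b q →⋆ₐ[ℂ] C(Ω, ℂ) where
  toFun := symbol
  map_one' := symbol_eq hq fun i => by simp
  map_mul' x y := symbol_eq hq fun i => by
    simp [apply_eq_symbol_smul, smul_smul, mul_comm]
  map_zero' := symbol_eq hq fun i => by simp
  map_add' x y := symbol_eq hq fun i => by simp [apply_eq_symbol_smul, add_smul]
  commutes' c := symbol_eq hq fun i => by simp [Algebra.algebraMap_eq_smul_one]
  map_star' x := symbol_eq hq (HilbertBasis.star_apply_eq_smul (apply_eq_symbol_smul x))

theorem symbolHom_injective (b : HilbertBasis ι ℂ H) {q : ι → Ω} (hq : Function.Surjective q) :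
    Function.Injective (symbolHom b hq) := by
  intro x y h
  refine Subtype.ext (HilbertBasis.clm_ext (b := b) fun i => ?_)
  rw [apply_eq_symbol_smul, apply_eq_symbol_smul]
  exact congrArg (fun f : C(Ω, ℂ) => f (q i) • b i) h

end Diagonal

theorem ContinuousMap.finiteDimensional_of_finite (Ω : Type*) [TopologicalSpace Ω] [Finite Ω] :
    FiniteDimensional ℂ C(Ω, ℂ) :=
  FiniteDimensional.of_injective (ContinuousMap.coeFnLinearMap ℂ : C(Ω, ℂ) →ₗ[ℂ] Ω → ℂ)
    DFunLike.coe_injective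

theorem ContinuousMap.starSubalgebra_eq_top_of_separatesPoints {Ω : Type*} [TopologicalSpace Ω]
    [Finite Ω] (S : StarSubalgebra ℂ C(Ω, ℂ)) (hS : S.SeparatesPoints) : S = ⊤ := by
  have := ContinuousMap.finiteDimensional_of_finite Ω
  rw [← ContinuousMap.starSubalgebra_topologicalClosure_eq_top_of_separatesPoints S hS]
  exact SetLike.coe_injective
    (Submodule.closed_of_finiteDimensional S.toSubalgebra.toSubmodule).closure_eq.symm

section Language

variable {d N : ℕ}

/-- The standard Hilbert basis of `ℓ²(Λ*)`. -/
def evecBasis (Λ : Set (MWord d N)) : HilbertBasis Λ ℂ (ell2 Λ) :=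
  HilbertBasis.ofRepr (LinearIsometryEquiv.refl ℂ _)

theorem evecBasis_apply (Λ : Set (MWord d N)) (w : Λ) : evecBasis Λ w = evec Λ w := by
  let := Classical.decEq Λ
  exact ((evecBasis Λ).repr_symm_single w).symm

theorem finite_mlen_le (n : Fin N → ℕ) : {w : MWord d N | mlen w ≤ n}.Finite := by
  have h : {w : MWord d N | mlen w ≤ n} =
      Set.univ.pi fun i => {l : FreeMonoid (Fin d) | l.length ≤ n i} := by
    ext w
    simp [mlen, Pi.le_def]
  rw [h]
  exact Set.Finite.pi fun i => List.finite_length_le (Fin d) (n i)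

theorem finite_omegaN (Λ : Set (MWord d N)) (n : Fin N → ℕ) : Finite (OmegaN Λ n) := by
  have := (finite_mlen_le (d := d) n).to_subtype
  let leftMultipliers : OmegaN Λ n → Set {w : MWord d N | mlen w ≤ n} :=
    Quotient.lift (fun μ : Λ => {w | (w : MWord d N) * μ ∈ Λ})
      fun _ _ h => Set.ext fun w => h w w.2
  refine Finite.of_injective leftMultipliers fun x y => ?_
  induction x using Quotient.inductionOn
  induction y using Quotient.inductionOn
  exact fun h => Quotient.sound fun w hw => Set.ext_iff.mp h ⟨w, hw⟩

theorem IsFL.mem_of_mul_mem {Λ : Set (MWord d N)} (hFL : IsFL Λ) {μ w : MWord d N}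
    (h : μ * w ∈ Λ) : μ ∈ Λ :=
  hFL.2 _ h _ ⟨1, w, by simp⟩

/-- The class `[w̄]_n̄`. -/
def OmegaN.mk (Λ : Set (MWord d N)) (n : Fin N → ℕ) (w : Λ) : OmegaN Λ n :=
  Quotient.mk (simSetoid Λ n) w

theorem OmegaN.mk_surjective (Λ : Set (MWord d N)) (n : Fin N → ℕ) :
    Function.Surjective (OmegaN.mk Λ n) :=
  Quotient.mk_surjective

instance (Λ : Set (MWord d N)) (n : Fin N → ℕ) : DiscreteTopology (OmegaN Λ n) := ⟨rfl⟩

open Classical in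
/-- The characteristic function of `{ [w̄]_n̄ : μ̄ * w̄ ∈ Λ* }`. -/
def leftMultiplierIndicator (Λ : Set (MWord d N)) {n : Fin N → ℕ} {μ : MWord d N}
    (hμ : mlen μ ≤ n) : C(OmegaN Λ n, ℂ) :=
  ⟨Quotient.lift (fun w : Λ => if μ * (w : MWord d N) ∈ Λ then 1 else 0)
    fun _ _ h => by simp only [h μ hμ], continuous_of_discreteTopology⟩

open Classical in
theorem leftMultiplierIndicator_mk (Λ : Set (MWord d N)) {n : Fin N → ℕ} {μ : MWord d N}
    (hμ : mlen μ ≤ n) (w : Λ) :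
    leftMultiplierIndicator Λ hμ (OmegaN.mk Λ n w) =
      if μ * (w : MWord d N) ∈ Λ then 1 else 0 :=
  rfl

open Classical in
theorem star_mul_self_apply_evec {Λ : Set (MWord d N)} {μ : MWord d N}
    {S : ell2 Λ →L[ℂ] ell2 Λ}
    (hS1 : ∀ (w : Λ) (h : μ * (w : MWord d N) ∈ Λ),
      S (evec Λ w) = evec Λ ⟨μ * (w : MWord d N), h⟩)
    (hS2 : ∀ w : Λ, μ * (w : MWord d N) ∉ Λ → S (evec Λ w) = 0) (w : Λ) :
    (star S * S) (evec Λ w) = (if μ * (w : MWord d N) ∈ Λ then 1 else 0 : ℂ) • evec Λ w := by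
  simp only [← evecBasis_apply] at *
  have hon := orthonormal_iff_ite.mp (evecBasis Λ).orthonormal
  refine (evecBasis Λ).repr.injective (lp.ext (funext fun v => ?_))
  rw [(evecBasis Λ).repr_apply_apply, (evecBasis Λ).repr_apply_apply,
    mul_apply_eq_comp, ContinuousLinearMap.star_eq_adjoint,
    ContinuousLinearMap.adjoint_inner_right, inner_smul_right, hon]
  by_cases hw : μ * (w : MWord d N) ∈ Λ
  · rw [hS1 w hw, if_pos hw, one_mul]
    by_cases hv : μ * (v : MWord d N) ∈ Λ
    · rw [hS1 v hv, hon]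
      simp only [mul_right_inj, Subtype.ext_iff]
    · rw [hS2 v hv, inner_zero_left, if_neg]
      rintro rfl
      exact hv hw
  · rw [hS2 w hw, inner_zero_right, if_neg hw, zero_mul]

end Language

/-- For a factorial language `Λ*` and `n̄ ∈ ℤ₊^N`, the quotient `Ω_n̄ = Λ*/∼_n̄` is finite and
there is a unital *-isomorphism `φ_n̄ : A_n̄ → C(Ω_n̄, ℂ)` such that for every `μ̄ ∈ Λ*` with
`|μ̄| ≤ n̄`, the image of `T_μ̄* T_μ̄` is the characteristic function of
`{ [w̄]_n̄ : μ̄ * w̄ ∈ Λ* }`. -/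
theorem checkersLe_iso_continuous_functions {d N : ℕ} (Λ : Set (MWord d N)) (hFL : IsFL Λ)
    (n : Fin N → ℕ) (T : MWord d N → (ell2 Λ →L[ℂ] ell2 Λ))
    (hT1 : ∀ (μ : MWord d N) (w : Λ) (h : μ * (w : MWord d N) ∈ Λ),
      T μ (evec Λ w) = evec Λ ⟨μ * (w : MWord d N), h⟩)
    (hT2 : ∀ (μ : MWord d N) (w : Λ), μ * (w : MWord d N) ∉ Λ → T μ (evec Λ w) = 0) :
    Finite (OmegaN Λ n) ∧
    ∃ φ : (checkersLe Λ T n) ≃⋆ₐ[ℂ] C(OmegaN Λ n, ℂ),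
      ∀ (μ : MWord d N) (hμ : μ ∈ Λ) (hlen : mlen μ ≤ n) (w : ↥Λ),
        (μ * (w : MWord d N) ∈ Λ →
          φ ⟨star (T μ) * T μ,
              StarSubalgebra.le_topologicalClosure _
                (StarAlgebra.subset_adjoin ℂ _ ⟨μ, hμ, hlen, rfl⟩)⟩
            (Quotient.mk (simSetoid Λ n) w) = 1) ∧
        (μ * (w : MWord d N) ∉ Λ →
          φ ⟨star (T μ) * T μ,
              StarSubalgebra.le_topologicalClosure _
                (StarAlgebra.subset_adjoin ℂ _ ⟨μ, hμ, hlen, rfl⟩)⟩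
            (Quotient.mk (simSetoid Λ n) w) = 0) := by
  have hfin := finite_omegaN Λ n
  refine ⟨hfin, ?_⟩
  have hq := OmegaN.mk_surjective Λ n
  have hgen (μ : MWord d N) (hlen : mlen μ ≤ n) (w : Λ) :
      (star (T μ) * T μ) (evecBasis Λ w) =
        leftMultiplierIndicator Λ hlen (OmegaN.mk Λ n w) • evecBasis Λ w := by
    rw [evecBasis_apply, leftMultiplierIndicator_mk]
    exact star_mul_self_apply_evec (hT1 μ) (hT2 μ) w
  have hle : checkersLe Λ T n ≤ diagonalThrough (evecBasis Λ) (OmegaN.mk Λ n) := by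
    refine StarSubalgebra.topologicalClosure_minimal (StarAlgebra.adjoin_le ?_)
      (isClosed_diagonalThrough _ hq)
    rintro _ ⟨μ, -, hlen, rfl⟩
    exact ⟨leftMultiplierIndicator Λ hlen, hgen μ hlen⟩
  let φ : checkersLe Λ T n →⋆ₐ[ℂ] C(OmegaN Λ n, ℂ) :=
    (symbolHom (evecBasis Λ) hq).comp (StarSubalgebra.inclusion hle)
  have hφ (μ : MWord d N) (hμ : μ ∈ Λ) (hlen : mlen μ ≤ n) :
      φ ⟨star (T μ) * T μ, StarSubalgebra.le_topologicalClosure _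
        (StarAlgebra.subset_adjoin ℂ _ ⟨μ, hμ, hlen, rfl⟩)⟩ = leftMultiplierIndicator Λ hlen :=
    symbol_eq hq (hgen μ hlen)
  have hinj : Function.Injective φ :=
    (symbolHom_injective (evecBasis Λ) hq).comp (Set.inclusion_injective hle)
  have hsep : φ.range.SeparatesPoints := by
    intro x y hxy
    obtain ⟨v, rfl⟩ := hq x
    obtain ⟨w, rfl⟩ := hq y
    have hvw : ¬ simRel Λ n v w := fun h => hxy (Quotient.sound h)
    simp only [simRel, not_forall] at hvw
    obtain ⟨μ, hlen, hne⟩ := hvw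
    have hμ : μ ∈ Λ := by
      by_contra hμ
      exact hne (iff_of_false (mt hFL.mem_of_mul_mem hμ) (mt hFL.mem_of_mul_mem hμ))
    refine ⟨_, ⟨leftMultiplierIndicator Λ hlen, ⟨_, hφ μ hμ hlen⟩, rfl⟩, ?_⟩
    change leftMultiplierIndicator Λ hlen _ ≠ leftMultiplierIndicator Λ hlen _
    rw [leftMultiplierIndicator_mk, leftMultiplierIndicator_mk]
    split_ifs <;> simp_all
  have hsurj : Function.Surjective φ := fun f =>
    (ContinuousMap.starSubalgebra_eq_top_of_separatesPoints φ.range hsep).ge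
      (StarSubalgebra.mem_top (x := f))
  have hbij : Function.Bijective φ := ⟨hinj, hsurj⟩
  refine ⟨StarAlgEquiv.ofBijective φ hbij, fun μ hμ hlen w => ?_⟩
  have hval := (DFunLike.congr_fun (hφ μ hμ hlen) (OmegaN.mk Λ n w)).trans
    (leftMultiplierIndicator_mk Λ hlen w)
  exact ⟨fun h => hval.trans (if_pos h), fun h => hval.trans (if_neg h)⟩

end
end

section
/- Let Λ* ⊆ (F⁺_d)^N be a factorial language and let ∅ ≠ F ⊆ [N]. If a ∈ I_F and ν̄ ∈ Λ* satisfies supp ν̄ ∩ F = ∅, then α_ν̄(a) = T_ν̄* a T_ν̄ belongs to I_F. In other words, I_F is invariant under the quantized dynamics in the directions perpendicular to F. -/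
open scoped ENNReal

noncomputable section

/-- `P_i = Σ_{k∈[d]} T_{δ_i(k)} T_{δ_i(k)}*`. -/
def Pproj {d N : ℕ} (Λ : Set (MWord d N)) (T : MWord d N → (ell2 Λ →L[ℂ] ell2 Λ))
    (i : Fin N) : ell2 Λ →L[ℂ] ell2 Λ :=
  ∑ k : Fin d, T (delta d N i k) * star (T (delta d N i k))

/-- `Q_F = Π_{i∈F} (I − P_i)`, the product taken in the increasing order of `[N]`
(the factors pairwise commute, so the order is immaterial); `Q_∅ = I`. -/
def Qproj {d N : ℕ} (Λ : Set (MWord d N)) (T : MWord d N → (ell2 Λ →L[ℂ] ell2 Λ))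
    (F : Finset (Fin N)) : ell2 Λ →L[ℂ] ell2 Λ :=
  ((List.finRange N).filter (· ∈ F)).foldr (fun i acc => (1 - Pproj Λ T i) * acc) 1

/-- `K_F = { a ∈ A : α_{δ_i(k)}(a) = 0 for all i ∈ F, k ∈ [d] }`. -/
def Kset {d N : ℕ} (Λ : Set (MWord d N)) (T : MWord d N → (ell2 Λ →L[ℂ] ell2 Λ))
    (F : Finset (Fin N)) : Set (ell2 Λ →L[ℂ] ell2 Λ) :=
  {a | a ∈ checkers Λ T ∧
    ∀ i ∈ F, ∀ k : Fin d, star (T (delta d N i k)) * a * T (delta d N i k) = 0}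

/-- `J_F = { a ∈ A : a b = 0 for all b ∈ K_F }`. -/
def Jset {d N : ℕ} (Λ : Set (MWord d N)) (T : MWord d N → (ell2 Λ →L[ℂ] ell2 Λ))
    (F : Finset (Fin N)) : Set (ell2 Λ →L[ℂ] ell2 Λ) :=
  {a | a ∈ checkers Λ T ∧ ∀ b ∈ Kset Λ T F, a * b = 0}

/-- `I_F = { a ∈ J_F : α_μ̄(a) ∈ J_F for all μ̄ ∈ Λ* with supp μ̄ ∩ F = ∅ }`. -/
def Iset {d N : ℕ} (Λ : Set (MWord d N)) (T : MWord d N → (ell2 Λ →L[ℂ] ell2 Λ))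
    (F : Finset (Fin N)) : Set (ell2 Λ →L[ℂ] ell2 Λ) :=
  {a | a ∈ Jset Λ T F ∧
    ∀ μ ∈ Λ, msupp μ ∩ (↑F : Set (Fin N)) = ∅ → star (T μ) * a * T μ ∈ Jset Λ T F}

end

noncomputable section

/-- Continuous linear maps on `ℓ²(Λ*)` agreeing on the standard basis are equal. -/
theorem ell2_clm_ext {d N : ℕ} {Λ : Set (MWord d N)} {S R : ell2 Λ →L[ℂ] ell2 Λ}
    (h : ∀ w : Λ, S (evec Λ w) = R (evec Λ w)) : S = R := by
  let := Classical.decEq (↥Λ)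
  ext1 x
  have hx := lp.hasSum_single (p := 2) (by norm_num) x
  refine (hx.mapL S).unique ?_
  convert hx.mapL R using 2 with w
  have hs : lp.single 2 w (x w) = x w • evec Λ w := by
    rw [evec, ← lp.single_smul, smul_eq_mul, mul_one]
  rw [hs, map_smul, map_smul, h]

/-- The zero operator belongs to `J_F`. -/
theorem zero_mem_Jset {d N : ℕ} (Λ : Set (MWord d N))
    (T : MWord d N → (ell2 Λ →L[ℂ] ell2 Λ)) (F : Finset (Fin N)) : 0 ∈ Jset Λ T F :=
  ⟨zero_mem _, fun _ _ => zero_mul _⟩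

/-- The creation operators are multiplicative on words. -/
theorem creation_mul {d N : ℕ} {Λ : Set (MWord d N)} (hFL : IsFL Λ)
    {T : MWord d N → (ell2 Λ →L[ℂ] ell2 Λ)}
    (hT1 : ∀ (μ : MWord d N) (w : Λ) (h : μ * (w : MWord d N) ∈ Λ),
      T μ (evec Λ w) = evec Λ ⟨μ * (w : MWord d N), h⟩)
    (hT2 : ∀ (μ : MWord d N) (w : Λ), μ * (w : MWord d N) ∉ Λ → T μ (evec Λ w) = 0)
    (ν μ : MWord d N) : T ν * T μ = T (ν * μ) := by
  refine ell2_clm_ext fun w => ?_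
  rw [mul_apply_eq_comp]
  by_cases hμ : μ * (w : MWord d N) ∈ Λ
  · rw [hT1 μ w hμ]
    by_cases hνμ : ν * (μ * (w : MWord d N)) ∈ Λ
    · rw [hT1 ν ⟨_, hμ⟩ hνμ, hT1 (ν * μ) w (by rwa [mul_assoc])]
      simp only [mul_assoc]
    · rw [hT2 ν ⟨_, hμ⟩ hνμ, hT2 (ν * μ) w (by rwa [mul_assoc])]
  · rw [hT2 μ w hμ, map_zero, hT2 (ν * μ) w]
    exact fun h => hμ (hFL.2 _ h _ ⟨ν, 1, by rw [mul_one, mul_assoc]⟩)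

/-- The creation operator of a word outside the language vanishes. -/
theorem creation_eq_zero {d N : ℕ} {Λ : Set (MWord d N)} (hFL : IsFL Λ)
    {T : MWord d N → (ell2 Λ →L[ℂ] ell2 Λ)}
    (hT2 : ∀ (μ : MWord d N) (w : Λ), μ * (w : MWord d N) ∉ Λ → T μ (evec Λ w) = 0)
    {μ : MWord d N} (hμ : μ ∉ Λ) : T μ = 0 := by
  refine ell2_clm_ext fun w => ?_
  rw [hT2 μ w fun h => hμ (hFL.2 _ h _ ⟨1, w, by rw [one_mul]⟩), zero_apply]

/-- The support of a product lies in the union of the supports. -/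
theorem msupp_mul_subset {d N : ℕ} (ν μ : MWord d N) : msupp (ν * μ) ⊆ msupp ν ∪ msupp μ := by
  intro i hi
  by_contra! h
  simp only [msupp, Set.mem_union, Set.mem_ofPred_eq, not_or, not_not] at h
  exact hi (by rw [Pi.mul_apply, h.1, h.2, one_mul])

/-- For a factorial language `Λ*` and `∅ ≠ F ⊆ [N]`, the ideal `I_F` is invariant under the
quantized dynamics in the directions perpendicular to `F`: if `a ∈ I_F` and `ν̄ ∈ Λ*` with
`supp ν̄ ∩ F = ∅`, then `α_ν̄(a) = T_ν̄* a T_ν̄ ∈ I_F`. -/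
theorem Iset_invariant_perp {d N : ℕ} (Λ : Set (MWord d N)) (hFL : IsFL Λ)
    (T : MWord d N → (ell2 Λ →L[ℂ] ell2 Λ))
    (hT1 : ∀ (μ : MWord d N) (w : Λ) (h : μ * (w : MWord d N) ∈ Λ),
      T μ (evec Λ w) = evec Λ ⟨μ * (w : MWord d N), h⟩)
    (hT2 : ∀ (μ : MWord d N) (w : Λ), μ * (w : MWord d N) ∉ Λ → T μ (evec Λ w) = 0)
    (F : Finset (Fin N)) (hF : F.Nonempty)
    (a : ell2 Λ →L[ℂ] ell2 Λ) (ha : a ∈ Iset Λ T F)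
    (ν : MWord d N) (hν : ν ∈ Λ) (hperp : msupp ν ∩ (↑F : Set (Fin N)) = ∅) :
    star (T ν) * a * T ν ∈ Iset Λ T F := by
  refine ⟨ha.2 ν hν hperp, fun μ _ hμF => ?_⟩
  have hcomp : star (T μ) * (star (T ν) * a * T ν) * T μ =
      star (T (ν * μ)) * a * T (ν * μ) := by
    rw [← creation_mul hFL hT1 hT2, star_mul]
    simp only [mul_assoc]
  rw [hcomp]
  by_cases hνμ : ν * μ ∈ Λ
  · refine ha.2 _ hνμ (Set.subset_empty_iff.mp ?_)
    calc msupp (ν * μ) ∩ (↑F : Set (Fin N))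
        ⊆ (msupp ν ∪ msupp μ) ∩ ↑F := Set.inter_subset_inter_left _ (msupp_mul_subset ν μ)
      _ = ∅ := by rw [Set.union_inter_distrib_right, hperp, hμF, Set.union_empty]
  · rw [creation_eq_zero hFL hT2 hνμ, mul_zero]
    exact zero_mem_Jset Λ T F

end
end

section
/- Let (Λ, d) be a strong finitely aligned higher rank graph of rank N, let ∅ ≠ F ⊆ [N], and let v be an F-tracing vertex. Then the set S := { μ ∈ vΛ^{𝐢} : i ∈ F } is a finite exhaustive subset of vΛ. -/
/-- A higher rank graph of rank `N`: a countable small category `Λ` — presented by its set of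
morphisms, with the vertices being the (identity) morphisms of degree `0̄` — together with a
degree functor `d : Λ → ℤ₊^N` satisfying the unique factorization property. -/
structure KGraph (N : ℕ) where
  /-- the morphisms (paths) of the category -/
  Mor : Type
  /-- the category is countable -/
  countable : Countable Mor
  /-- the source vertex of a morphism -/
  src : Mor → Mor
  /-- the range vertex of a morphism -/
  rng : Mor → Mor
  /-- composition `λμ` of morphisms, defined when `s(λ) = r(μ)` -/
  comp : ∀ l m : Mor, src l = rng m → Mor
  /-- the degree functor `d : Λ → ℤ₊^N` -/
  deg : Mor → Fin N → ℕ
  src_src : ∀ l, src (src l) = src l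
  rng_src : ∀ l, rng (src l) = src l
  src_rng : ∀ l, src (rng l) = rng l
  rng_rng : ∀ l, rng (rng l) = rng l
  deg_src : ∀ l, deg (src l) = 0
  deg_rng : ∀ l, deg (rng l) = 0
  /-- vertices (degree-`0̄` morphisms) are identities -/
  src_of_deg_zero : ∀ v, deg v = 0 → src v = v
  rng_of_deg_zero : ∀ v, deg v = 0 → rng v = v
  comp_id : ∀ (l : Mor) (h : src l = rng (src l)), comp l (src l) h = l
  id_comp : ∀ (l : Mor) (h : src (rng l) = rng l), comp (rng l) l h = l
  src_comp : ∀ l m h, src (comp l m h) = src m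
  rng_comp : ∀ l m h, rng (comp l m h) = rng l
  deg_comp : ∀ l m h, deg (comp l m h) = deg l + deg m
  comp_assoc : ∀ (l m n : Mor) (h1 : src l = rng m) (h2 : src m = rng n)
    (h3 : src (comp l m h1) = rng n) (h4 : src l = rng (comp m n h2)),
    comp (comp l m h1) n h3 = comp l (comp m n h2) h4
  /-- unique factorization: existence -/
  factor : ∀ (l : Mor) (m n : Fin N → ℕ), deg l = m + n →
    ∃ (p q : Mor) (h : src p = rng q), comp p q h = l ∧ deg p = m ∧ deg q = n
  /-- unique factorization: uniqueness -/
  factor_unique : ∀ (p q : Mor) (h : src p = rng q) (p' q' : Mor) (h' : src p' = rng q'),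
    comp p q h = comp p' q' h' → deg p = deg p' → p = p' ∧ q = q'

namespace KGraph

variable {N : ℕ} (G : KGraph N)

/-- The `i`-th generator of `ℤ₊^N`. -/
def gen (N : ℕ) (i : Fin N) : Fin N → ℕ := Pi.single i 1

/-- A vertex is a morphism of degree `0̄`. -/
def IsVertex (v : G.Mor) : Prop := G.deg v = 0

/-- `vΛ`, the morphisms with range `v`. -/
def vLam (v : G.Mor) : Set G.Mor := {l | G.rng l = v}

/-- `vΛ^n̄`, the morphisms with range `v` and degree `n̄`. -/
def withRngDeg (v : G.Mor) (n : Fin N → ℕ) : Set G.Mor :=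
  {l | G.rng l = v ∧ G.deg l = n}

/-- `Λ^min(λ,μ)`: the pairs `(α,β)` with `λα = μβ` and `d(λα) = d(λ) ∨ d(μ)`. -/
def minExt (l m : G.Mor) : Set (G.Mor × G.Mor) :=
  {p | ∃ (h1 : G.src l = G.rng p.1) (h2 : G.src m = G.rng p.2),
    G.comp l p.1 h1 = G.comp m p.2 h2 ∧
    G.deg l + G.deg p.1 = G.deg l ⊔ G.deg m ∧
    G.deg m + G.deg p.2 = G.deg l ⊔ G.deg m}

/-- `Λ` is finitely aligned if all the sets `Λ^min(λ,μ)` are finite. -/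
def FinitelyAligned : Prop := ∀ l m : G.Mor, (G.minExt l m).Finite

/-- `Λ` is strong finitely aligned if it is finitely aligned and moreover for every `λ` and
every `i ∉ supp d(λ)` there are only finitely many edges `e ∈ Λ^𝐢` with `Λ^min(λ,e) ≠ ∅`. -/
def StrongFinitelyAligned : Prop :=
  G.FinitelyAligned ∧ ∀ (l : G.Mor) (i : Fin N), G.deg l i = 0 →
    {e : G.Mor | G.deg e = gen N i ∧ (G.minExt l e).Nonempty}.Finite

/-- A subset `S ⊆ vΛ` is exhaustive if every `λ ∈ vΛ` has a common extension with some
member of `S`. -/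
def Exhaustive (v : G.Mor) (S : Set G.Mor) : Prop :=
  ∀ l ∈ G.vLam v, ∃ m ∈ S, (G.minExt l m).Nonempty

/-- A vertex `v` is `F`-tracing if every `λ ∈ vΛ` with `supp d(λ) ∩ F = ∅` satisfies:
`s(λ)Λ^𝐢 ≠ ∅` for at least one `i ∈ F`, and `s(λ)Λ^𝐢` is finite for all `i ∈ [N]`. -/
def FTracing (v : G.Mor) (F : Finset (Fin N)) : Prop :=
  ∀ l ∈ G.vLam v, (∀ i ∈ F, G.deg l i = 0) →
    (∃ i ∈ F, (G.withRngDeg (G.src l) (gen N i)).Nonempty) ∧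
    ∀ i : Fin N, (G.withRngDeg (G.src l) (gen N i)).Finite

/-- A Toeplitz–Cuntz–Krieger `Λ`-family on a Hilbert space `H`. -/
def IsTCK {H : Type} [NormedAddCommGroup H] [InnerProductSpace ℂ H] [CompleteSpace H]
    (T : G.Mor → (H →L[ℂ] H)) : Prop :=
  (∀ v : G.Mor, G.IsVertex v → IsSelfAdjoint (T v) ∧ T v * T v = T v) ∧
  (∀ v w : G.Mor, G.IsVertex v → G.IsVertex w → v ≠ w → T v * T w = 0) ∧
  (∀ (l m : G.Mor) (h : G.src l = G.rng m), T l * T m = T (G.comp l m h)) ∧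
  (∀ l m : G.Mor, G.src l ≠ G.rng m → T l * T m = 0) ∧
  (∀ l m : G.Mor, star (T l) * T m = ∑ᶠ p ∈ G.minExt l m, T p.1 * star (T p.2))

/-- A Cuntz–Krieger `Λ`-family: a TCK family satisfying moreover
`Π_{λ∈S} (T_v − T_λ T_λ*) = 0` for every vertex `v` and every non-empty finite exhaustive
`S ⊆ vΛ` (the factors pairwise commute, so the product is stated for every enumeration
of `S`). -/
def IsCK {H : Type} [NormedAddCommGroup H] [InnerProductSpace ℂ H] [CompleteSpace H]
    (T : G.Mor → (H →L[ℂ] H)) : Prop :=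
  G.IsTCK T ∧
  ∀ v : G.Mor, G.IsVertex v → ∀ S : Set G.Mor, S ⊆ G.vLam v → S.Finite → S.Nonempty →
    G.Exhaustive v S → ∀ L : List G.Mor, L.Nodup → (∀ x, x ∈ L ↔ x ∈ S) →
      (L.map (fun l => T v - T l * star (T l))).prod = 0

end KGraph

/-- In a strong finitely aligned higher rank graph of rank `N`, for `∅ ≠ F ⊆ [N]` and an
`F`-tracing vertex `v`, the set `S = { μ ∈ vΛ^𝐢 : i ∈ F }` is a finite exhaustive subset
of `vΛ`. -/
theorem KGraph.ftracing_finite_exhaustive {N : ℕ} (G : KGraph N)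
    (hG : G.StrongFinitelyAligned) (F : Finset (Fin N)) (hF : F.Nonempty)
    (v : G.Mor) (hv : G.IsVertex v) (htr : G.FTracing v F) :
    {μ : G.Mor | G.rng μ = v ∧ ∃ i ∈ F, G.deg μ = KGraph.gen N i}.Finite ∧
    {μ : G.Mor | G.rng μ = v ∧ ∃ i ∈ F, G.deg μ = KGraph.gen N i} ⊆ G.vLam v ∧
    G.Exhaustive v {μ : G.Mor | G.rng μ = v ∧ ∃ i ∈ F, G.deg μ = KGraph.gen N i} := by
  have hvv : v ∈ G.vLam v := G.rng_of_deg_zero v hv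
  have hv0 : ∀ i ∈ F, G.deg v i = 0 := fun i _ => congrFun hv i
  refine ⟨?_, fun μ hμ => hμ.1, ?_⟩
  · have hsv : G.src v = v := G.src_of_deg_zero v hv
    have hfin := (htr v hvv hv0).2
    rw [hsv] at hfin
    refine (F.finite_toSet.biUnion fun i _ => hfin i).subset ?_
    rintro μ ⟨hr, i, hi, hd⟩
    exact Set.mem_biUnion (Finset.mem_coe.mpr hi) ⟨hr, hd⟩
  · intro l hl
    by_cases h0 : ∀ i ∈ F, G.deg l i = 0
    · obtain ⟨⟨i, hi, f, hfr, hfd⟩, -⟩ := htr l hl h0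
      have hdeg : G.deg (G.comp l f hfr.symm) = gen N i + G.deg l := by
        rw [G.deg_comp, hfd, add_comm]
      obtain ⟨e, g, h, hc, he, hg⟩ := G.factor _ _ _ hdeg
      have hre : G.rng e = v := by
        rw [← G.rng_comp e g h, hc, G.rng_comp]
        exact hl
      have hsup : G.deg l + gen N i = G.deg l ⊔ gen N i := by
        funext j
        by_cases hj : j = i
        · subst hj
          simp [gen, h0 j hi]
        · simp [gen, hj]
      refine ⟨e, ⟨hre, i, hi, he⟩, (f, g), hfr.symm, h, hc.symm, ?_, ?_⟩
      · rw [hfd, he, hsup]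
      · rw [hg, he, add_comm, hsup]
    · push Not at h0
      obtain ⟨i, hi, hli⟩ := h0
      have hle : gen N i ≤ G.deg l := by
        intro j
        by_cases hj : j = i
        · subst hj
          simpa [gen] using Nat.one_le_iff_ne_zero.mpr hli
        · simp [gen, hj]
      obtain ⟨n, hn⟩ := exists_add_of_le hle
      obtain ⟨e, g, h, hc, he, hg⟩ := G.factor l _ _ hn
      have hre : G.rng e = v := by
        rw [← G.rng_comp e g h, hc]
        exact hl
      refine ⟨e, ⟨hre, i, hi, he⟩, (G.src l, g), (G.rng_src l).symm, h, ?_, ?_, ?_⟩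
      · rw [G.comp_id, hc]
      · rw [G.deg_src, add_zero, he, sup_eq_left.mpr hle]
      · rw [he, hg, sup_eq_left.mpr hle, hn]
end

section
/- Let (Λ, d) be a finitely aligned higher rank graph of rank N, let { T_λ }_{λ∈Λ} be a Toeplitz–Cuntz–Krieger Λ-family on a Hilbert space H, let ∅ ≠ F ⊆ [N], and let v be a vertex such that vΛ^{𝐢} is finite for every i ∈ F. Then { λ ∈ vΛ : d(λ) ≤ 1̄_F } is finite and Π_{i∈F} ( T_v − Σ_{μ∈vΛ^{𝐢}} T_μ T_μ* ) = Σ { (−1)^{|d(λ)|} T_λ T_λ* : λ ∈ vΛ, d(λ) ≤ 1̄_F }, where 1̄_F := Σ_{i∈F} 𝐢 and |n̄| := n_1 + ⋯ + n_N. -/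
namespace KGraph

variable {N : ℕ} (G : KGraph N)

open Classical in
/-- Composition of morphisms, extended by the junk value `l` to non-composable pairs. -/
noncomputable def compTotal (l a : G.Mor) : G.Mor :=
  if h : G.src l = G.rng a then G.comp l a h else l

/-- The common extensions `λα = μβ` of `λ` and `μ` with `(α, β) ∈ Λ^min(λ,μ)`. -/
def minCommonExt (l m : G.Mor) : Set G.Mor :=
  (fun p : G.Mor × G.Mor => G.compTotal l p.1) '' G.minExt l m

variable {G}

lemma compTotal_eq {l a : G.Mor} (h : G.src l = G.rng a) : G.compTotal l a = G.comp l a h :=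
  dif_pos h

lemma injOn_compTotal_minExt (l m : G.Mor) :
    Set.InjOn (fun p : G.Mor × G.Mor => G.compTotal l p.1) (G.minExt l m) := by
  rintro ⟨a, b⟩ ⟨h1, h2, e, -, -⟩ ⟨a', b'⟩ ⟨h1', h2', e', -, -⟩ h
  simp only [compTotal_eq h1, compTotal_eq h1'] at h
  obtain ⟨-, rfl⟩ := G.factor_unique _ _ _ _ _ _ h rfl
  obtain ⟨-, rfl⟩ := G.factor_unique _ _ _ _ _ _ (e.symm.trans e') rfl
  rfl

lemma pairwiseDisjoint_minCommonExt (v : G.Mor) (m n : Fin N → ℕ) :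
    (G.withRngDeg v m ×ˢ G.withRngDeg v n).PairwiseDisjoint
      (fun q => G.minCommonExt q.1 q.2) := by
  rintro ⟨l, k⟩ ⟨hl, hk⟩ ⟨l', k'⟩ ⟨hl', hk'⟩ hne
  refine Set.disjoint_left.2 ?_
  rintro x ⟨⟨a, b⟩, ⟨h1, h2, e, -, -⟩, rfl⟩ ⟨⟨a', b'⟩, ⟨h1', h2', e', -, -⟩, hx⟩
  simp only at *
  rw [compTotal_eq h1, compTotal_eq h1'] at hx
  obtain ⟨rfl, -⟩ := G.factor_unique _ _ _ _ _ _ hx (hl'.2.trans hl.2.symm)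
  obtain ⟨rfl, -⟩ := G.factor_unique _ _ _ _ _ _ (e'.symm.trans (hx.trans e))
    (hk'.2.trans hk.2.symm)
  exact hne rfl

lemma biUnion_minCommonExt (v : G.Mor) (m n : Fin N → ℕ) :
    ⋃ q ∈ G.withRngDeg v m ×ˢ G.withRngDeg v n, G.minCommonExt q.1 q.2 =
      G.withRngDeg v (m ⊔ n) := by
  ext x
  simp only [Set.mem_iUnion, exists_prop]
  constructor
  · rintro ⟨⟨l, k⟩, ⟨⟨rfl, rfl⟩, -, rfl⟩, ⟨a, b⟩, ⟨h1, h2, -, d, -⟩, rfl⟩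
    simp only at *
    rw [compTotal_eq h1]
    exact ⟨G.rng_comp _ _ _, (G.deg_comp _ _ _).trans d⟩
  · rintro ⟨rfl, hd⟩
    obtain ⟨l, a, h1, rfl, rfl, da⟩ := G.factor x m (m ⊔ n - m)
      (hd.trans (add_tsub_cancel_of_le le_sup_left).symm)
    obtain ⟨k, b, h2, e, rfl, db⟩ := G.factor (G.comp l a h1) n (G.deg l ⊔ n - n)
      (hd.trans (add_tsub_cancel_of_le le_sup_right).symm)
    refine ⟨(l, k), ⟨⟨(G.rng_comp _ _ _).symm, rfl⟩, ?_, rfl⟩, (a, b), ⟨h1, h2, e.symm, ?_, ?_⟩,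
      compTotal_eq h1⟩
    · rw [← e, G.rng_comp]
    · simp only [da, add_tsub_cancel_of_le le_sup_left]
    · simp only [db, add_tsub_cancel_of_le le_sup_right]

lemma FinitelyAligned.finite_withRngDeg_sup (hG : G.FinitelyAligned) {v : G.Mor}
    {m n : Fin N → ℕ} (hm : (G.withRngDeg v m).Finite) (hn : (G.withRngDeg v n).Finite) :
    (G.withRngDeg v (m ⊔ n)).Finite := by
  rw [← biUnion_minCommonExt]
  exact (hm.prod hn).biUnion fun q _ => (hG q.1 q.2).image _

lemma withRngDeg_zero {v : G.Mor} (hv : G.IsVertex v) : G.withRngDeg v 0 = {v} := by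
  ext x
  simp only [withRngDeg, Set.mem_ofPred_eq, Set.mem_singleton_iff]
  constructor
  · rintro ⟨rfl, h⟩
    exact (G.rng_of_deg_zero x h).symm
  · rintro rfl
    exact ⟨G.rng_of_deg_zero x hv, hv⟩

/-- The indicator degree `1̄_S`. -/
def indicatorDeg (S : Finset (Fin N)) : Fin N → ℕ := fun i => if i ∈ S then 1 else 0

lemma indicatorDeg_empty : indicatorDeg (∅ : Finset (Fin N)) = 0 := by
  ext i
  simp [indicatorDeg]

lemma indicatorDeg_insert (i : Fin N) (S : Finset (Fin N)) :
    indicatorDeg (insert i S) = gen N i ⊔ indicatorDeg S := by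
  ext j
  by_cases hj : j = i <;> by_cases hS : j ∈ S <;>
    simp_all [indicatorDeg, gen]

lemma indicatorDeg_injective : Function.Injective (indicatorDeg (N := N)) := by
  intro S S' h
  ext i
  have := congrFun h i
  by_cases h1 : i ∈ S <;> by_cases h2 : i ∈ S' <;> simp_all [indicatorDeg]

lemma sum_indicatorDeg (S : Finset (Fin N)) : ∑ i, indicatorDeg S i = S.card := by
  simp [indicatorDeg]

lemma setOf_deg_le_indicatorDeg (v : G.Mor) (F : Finset (Fin N)) :
    {l : G.Mor | G.rng l = v ∧ G.deg l ≤ indicatorDeg F} =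
      ⋃ S ∈ (F.powerset : Set (Finset (Fin N))), G.withRngDeg v (indicatorDeg S) := by
  ext l
  simp only [Set.mem_ofPred_eq, Set.mem_iUnion, exists_prop, Finset.mem_coe, Finset.mem_powerset,
    withRngDeg]
  constructor
  · rintro ⟨rfl, h⟩
    have hF (i : Fin N) : G.deg l i ≤ if i ∈ F then 1 else 0 := h i
    refine ⟨F.filter fun i => G.deg l i ≠ 0, Finset.filter_subset _ _, rfl, ?_⟩
    ext i
    have := hF i
    simp only [indicatorDeg, Finset.mem_filter]
    split_ifs at this ⊢ <;> grind
  · rintro ⟨S, hS, rfl, h⟩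
    refine ⟨rfl, fun i => ?_⟩
    rw [h]
    simp only [indicatorDeg]
    have := @hS i
    split_ifs <;> grind

lemma FinitelyAligned.finite_withRngDeg_indicatorDeg (hG : G.FinitelyAligned) {v : G.Mor}
    (hv : G.IsVertex v) {S : Finset (Fin N)} (h : ∀ i ∈ S, (G.withRngDeg v (gen N i)).Finite) :
    (G.withRngDeg v (indicatorDeg S)).Finite := by
  induction S using Finset.induction_on with
  | empty => simp [indicatorDeg_empty, withRngDeg_zero hv]
  | insert i S _ ih =>
    rw [indicatorDeg_insert]
    exact hG.finite_withRngDeg_sup (h i (Finset.mem_insert_self _ _))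
      (ih fun j hj => h j (Finset.mem_insert_of_mem hj))

variable {H : Type} [NormedAddCommGroup H] [InnerProductSpace ℂ H] [CompleteSpace H]
  {T : G.Mor → (H →L[ℂ] H)}

/-- The sum of the range projections `T_λ T_λ*` over `λ ∈ vΛ^n̄`. -/
noncomputable def rangeSum (T : G.Mor → (H →L[ℂ] H)) (v : G.Mor) (n : Fin N → ℕ) : H →L[ℂ] H :=
  ∑ᶠ l ∈ G.withRngDeg v n, T l * star (T l)

lemma IsTCK.rangeSum_zero (hT : G.IsTCK T) {v : G.Mor} (hv : G.IsVertex v) :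
    rangeSum T v 0 = T v := by
  rw [rangeSum, withRngDeg_zero hv, finsum_mem_singleton, (hT.1 v hv).1.star_eq, (hT.1 v hv).2]

lemma IsTCK.mul_eq_finsum_minCommonExt (hT : G.IsTCK T) (hG : G.FinitelyAligned) (l m : G.Mor) :
    T l * star (T l) * (T m * star (T m)) =
      ∑ᶠ x ∈ G.minCommonExt l m, T x * star (T x) := by
  obtain ⟨-, -, hcomp, -, hNC⟩ := hT
  rw [minCommonExt, finsum_mem_image (injOn_compTotal_minExt l m)]
  calc T l * star (T l) * (T m * star (T m))
      = T l * (star (T l) * T m) * star (T m) := by simp only [mul_assoc]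
    _ = _ := by
      rw [hNC, finsum_mem_eq_finite_toFinset_sum _ (hG l m),
        finsum_mem_eq_finite_toFinset_sum _ (hG l m), Finset.mul_sum, Finset.sum_mul]
      refine Finset.sum_congr rfl ?_
      rintro ⟨a, b⟩ hp
      obtain ⟨h1, h2, e, -, -⟩ := (Set.Finite.mem_toFinset _).1 hp
      simp only at *
      rw [compTotal_eq h1]
      nth_rw 2 [e]
      rw [← hcomp, ← hcomp, star_mul]
      simp only [mul_assoc]

lemma IsTCK.rangeSum_mul_rangeSum (hT : G.IsTCK T) (hG : G.FinitelyAligned) {v : G.Mor}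
    {m n : Fin N → ℕ} (hm : (G.withRngDeg v m).Finite) (hn : (G.withRngDeg v n).Finite) :
    rangeSum T v m * rangeSum T v n = rangeSum T v (m ⊔ n) := by
  rw [rangeSum, rangeSum, rangeSum, ← biUnion_minCommonExt,
    finsum_mem_biUnion (pairwiseDisjoint_minCommonExt v m n) (hm.prod hn)
      fun q _ => (hG q.1 q.2).image _,
    finsum_mem_eq_finite_toFinset_sum _ hm, finsum_mem_eq_finite_toFinset_sum _ hn,
    finsum_mem_eq_finite_toFinset_sum _ (hm.prod hn), Finset.sum_mul_sum,
    ← Finset.sum_product', Set.Finite.toFinset_prod]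
  exact Finset.sum_congr rfl fun q _ => hT.mul_eq_finsum_minCommonExt hG q.1 q.2

lemma IsTCK.vertex_mul_rangeSum (hT : G.IsTCK T) (hG : G.FinitelyAligned) {v : G.Mor}
    (hv : G.IsVertex v) {n : Fin N → ℕ} (hn : (G.withRngDeg v n).Finite) :
    T v * rangeSum T v n = rangeSum T v n := by
  have h0 : (G.withRngDeg v 0).Finite := by simp [withRngDeg_zero hv]
  rw [← hT.rangeSum_zero hv, hT.rangeSum_mul_rangeSum hG h0 hn,
    sup_eq_right.2 fun _ => Nat.zero_le _]

lemma IsTCK.rangeSum_mul_vertex (hT : G.IsTCK T) (hG : G.FinitelyAligned) {v : G.Mor}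
    (hv : G.IsVertex v) {n : Fin N → ℕ} (hn : (G.withRngDeg v n).Finite) :
    rangeSum T v n * T v = rangeSum T v n := by
  have h0 : (G.withRngDeg v 0).Finite := by simp [withRngDeg_zero hv]
  rw [← hT.rangeSum_zero hv, hT.rangeSum_mul_rangeSum hG hn h0,
    sup_eq_left.2 fun _ => Nat.zero_le _]

lemma IsTCK.mul_foldr_eq_sum_powerset (hT : G.IsTCK T) (hG : G.FinitelyAligned) {v : G.Mor}
    (hv : G.IsVertex v) (L : List (Fin N)) (hL : L.Nodup)
    (hfin : ∀ i ∈ L, (G.withRngDeg v (gen N i)).Finite) :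
    T v * L.foldr (fun i acc => (T v - rangeSum T v (gen N i)) * acc) 1 =
      ∑ S ∈ L.toFinset.powerset, (-1 : ℂ) ^ S.card • rangeSum T v (indicatorDeg S) := by
  induction L with
  | nil => simp [indicatorDeg_empty, hT.rangeSum_zero hv]
  | cons i L ih =>
    obtain ⟨hi, hL⟩ := List.nodup_cons.1 hL
    have hfi := hfin i List.mem_cons_self
    have hfL : ∀ j ∈ L, (G.withRngDeg v (gen N j)).Finite :=
      fun j hj => hfin j (List.mem_cons_of_mem _ hj)
    have hcomm : T v * (T v - rangeSum T v (gen N i)) =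
        (T v - rangeSum T v (gen N i)) * T v := by
      rw [mul_sub, sub_mul, hT.vertex_mul_rangeSum hG hv hfi, hT.rangeSum_mul_vertex hG hv hfi]
    rw [List.foldr_cons, ← mul_assoc, hcomm, mul_assoc, ih hL hfL, List.toFinset_cons,
      Finset.sum_powerset_insert (by simpa using hi), sub_mul, sub_eq_add_neg]
    have hS : ∀ S ∈ L.toFinset.powerset, (G.withRngDeg v (indicatorDeg S)).Finite :=
      fun S hS => hG.finite_withRngDeg_indicatorDeg hv fun j hj =>
        hfL j (List.mem_toFinset.1 (Finset.mem_powerset.1 hS hj))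
    congr 1
    · rw [Finset.mul_sum]
      refine Finset.sum_congr rfl fun S hSL => ?_
      rw [mul_smul_comm, hT.vertex_mul_rangeSum hG hv (hS S hSL)]
    · rw [Finset.mul_sum, ← Finset.sum_neg_distrib]
      refine Finset.sum_congr rfl fun S hSL => ?_
      have hiS : i ∉ S := fun h => hi (List.mem_toFinset.1 (Finset.mem_powerset.1 hSL h))
      rw [mul_smul_comm, hT.rangeSum_mul_rangeSum hG hfi (hS S hSL), indicatorDeg_insert,
        Finset.card_insert_of_notMem hiS, pow_succ, mul_neg_one, neg_smul]

lemma IsTCK.foldr_eq_sum_powerset (hT : G.IsTCK T) (hG : G.FinitelyAligned) {v : G.Mor}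
    (hv : G.IsVertex v) (L : List (Fin N)) (hL : L.Nodup) (hne : L ≠ [])
    (hfin : ∀ i ∈ L, (G.withRngDeg v (gen N i)).Finite) :
    L.foldr (fun i acc => (T v - rangeSum T v (gen N i)) * acc) 1 =
      ∑ S ∈ L.toFinset.powerset, (-1 : ℂ) ^ S.card • rangeSum T v (indicatorDeg S) := by
  rw [← hT.mul_foldr_eq_sum_powerset hG hv L hL hfin]
  obtain ⟨i, L, rfl⟩ := List.exists_cons_of_ne_nil hne
  rw [List.foldr_cons, ← mul_assoc, mul_sub, (hT.1 v hv).2,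
    hT.vertex_mul_rangeSum hG hv (hfin i List.mem_cons_self)]

end KGraph

/-- Let `Λ` be a finitely aligned higher rank graph of rank `N`, `{T_λ}` a
Toeplitz–Cuntz–Krieger `Λ`-family on a Hilbert space `H`, `∅ ≠ F ⊆ [N]`, and `v` a vertex
with `vΛ^𝐢` finite for every `i ∈ F`.  Then `{ λ ∈ vΛ : d(λ) ≤ 1̄_F }` is finite and
`Π_{i∈F} ( T_v − Σ_{μ∈vΛ^𝐢} T_μ T_μ* ) = Σ { (−1)^{|d(λ)|} T_λ T_λ* : λ ∈ vΛ, d(λ) ≤ 1̄_F }`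
(the product over `F` is taken in the increasing order of `[N]`; its factors commute). -/
theorem KGraph.prod_diff_eq_alternating_sum {N : ℕ} (G : KGraph N)
    (hG : G.FinitelyAligned) {H : Type} [NormedAddCommGroup H] [InnerProductSpace ℂ H]
    [CompleteSpace H] (T : G.Mor → (H →L[ℂ] H)) (hT : G.IsTCK T)
    (F : Finset (Fin N)) (hF : F.Nonempty) (v : G.Mor) (hv : G.IsVertex v)
    (hfin : ∀ i ∈ F, (G.withRngDeg v (KGraph.gen N i)).Finite) :
    {l : G.Mor | G.rng l = v ∧ G.deg l ≤ fun i => if i ∈ F then 1 else 0}.Finite ∧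
    ((List.finRange N).filter (· ∈ F)).foldr
        (fun i acc => (T v - ∑ᶠ μ ∈ G.withRngDeg v (KGraph.gen N i), T μ * star (T μ)) * acc)
        1 =
      ∑ᶠ l ∈ {l : G.Mor | G.rng l = v ∧ G.deg l ≤ fun i => if i ∈ F then 1 else 0},
        ((-1 : ℂ) ^ (∑ i : Fin N, G.deg l i)) • (T l * star (T l)) := by
  have hS : ∀ S ∈ (F.powerset : Set (Finset (Fin N))),
      (G.withRngDeg v (indicatorDeg S)).Finite := fun S hS =>
    hG.finite_withRngDeg_indicatorDeg hv fun j hj => hfin j (Finset.mem_powerset.1 hS hj)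
  have hset : {l : G.Mor | G.rng l = v ∧ G.deg l ≤ fun i => if i ∈ F then 1 else 0} =
      ⋃ S ∈ (F.powerset : Set (Finset (Fin N))), G.withRngDeg v (indicatorDeg S) :=
    setOf_deg_le_indicatorDeg v F
  have hdisj : (F.powerset : Set (Finset (Fin N))).PairwiseDisjoint
      fun S => G.withRngDeg v (indicatorDeg S) := fun S _ S' _ hne =>
    Set.disjoint_left.2 fun l hl hl' => hne (indicatorDeg_injective (hl.2.symm.trans hl'.2))
  have hL : ((List.finRange N).filter (· ∈ F)).toFinset = F := by
    ext i
    simp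
  rw [hset]
  refine ⟨F.powerset.finite_toSet.biUnion hS, ?_⟩
  refine (hT.foldr_eq_sum_powerset hG hv _ ((List.nodup_finRange N).filter _) ?_ ?_).trans ?_
  · rintro h
    rw [h] at hL
    exact hF.ne_empty hL.symm
  · intro i hi
    exact hfin i (by simpa using hi)
  · rw [hL, finsum_mem_biUnion hdisj F.powerset.finite_toSet hS, finsum_mem_coe_finset]
    refine Finset.sum_congr rfl fun S hSF => ?_
    rw [rangeSum, finsum_mem_eq_finite_toFinset_sum _ (hS S hSF),
      finsum_mem_eq_finite_toFinset_sum _ (hS S hSF), Finset.smul_sum]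
    refine Finset.sum_congr rfl fun l hl => ?_
    rw [((Set.Finite.mem_toFinset _).1 hl).2, sum_indicatorDeg]
end
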